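/- For every n ∈ ℕ, nonnegative real k, x ∈ [0,1], and every continuous f : [0,1] → ℝ, one has |P_{n,k}^{⟨k/n⟩}(f;x) − f(x)| ≤ (3/2)·ω(f, √((k+1)/(n+k))), where ω(f,δ) = sup{|f(t)−f(x)| : x,t ∈ [0,1], |t−x| ≤ δ} is the modulus of continuity of f. -/

import Mathlib

open Finset Filter

/-- Pochhammer k-symbol: `(λ)_{m,k} = λ(λ+k)⋯(λ+(m-1)k)`. -/
noncomputable def pochK (lam k : ℝ) (m : ℕ) : ℝ :=
  ∏ i ∈ Finset.range m, (lam + i * k)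

/-- Lupaş-type operator based on Polya distribution with Pochhammer k-symbol. -/
noncomputable def LupasP (n : ℕ) (k : ℝ) (f : ℝ → ℝ) (x : ℝ) : ℝ :=
  (1 / pochK n k n) * ∑ m ∈ Finset.range (n + 1),
    (n.choose m : ℝ) * pochK (n * x) k m * pochK (n - n * x) k (n - m) * f (m / n)

/-- Kantorovich-Stancu modification of the Lupaş-type operator. -/
noncomputable def KantK (n : ℕ) (α β k : ℝ) (f : ℝ → ℝ) (x : ℝ) : ℝ :=
  ((n + β + 1) / pochK n k n) * ∑ m ∈ Finset.range (n + 1),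
    (n.choose m : ℝ) * pochK (n * x) k m * pochK (n - n * x) k (n - m) *
      ∫ t in ((m + α) / (n + β + 1))..((m + α + 1) / (n + β + 1)), f t

/-- Modulus of continuity of `f` on `[0,1]`. -/
noncomputable def modulus (f : ℝ → ℝ) (δ : ℝ) : ℝ :=
  sSup {y | ∃ x t : ℝ, x ∈ Set.Icc (0:ℝ) 1 ∧ t ∈ Set.Icc (0:ℝ) 1 ∧
    |t - x| ≤ δ ∧ y = |f t - f x|}

theorem pochK_succ (a k : ℝ) (m : ℕ) : pochK a k (m + 1) = pochK a k m * (a + m * k) :=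
  Finset.prod_range_succ _ _

theorem pochK_nonneg {a k : ℝ} (ha : 0 ≤ a) (hk : 0 ≤ k) (m : ℕ) : 0 ≤ pochK a k m :=
  Finset.prod_nonneg fun _ _ => by positivity

theorem pochK_pos {a k : ℝ} (ha : 0 < a) (hk : 0 ≤ k) (m : ℕ) : 0 < pochK a k m :=
  Finset.prod_pos fun _ _ => by positivity

/-- The unnormalized expectation of `g` under the Pólya distribution. -/
noncomputable def polyaSum (a b k : ℝ) (n : ℕ) (g : ℕ → ℝ) : ℝ :=
  ∑ ij ∈ antidiagonal n, (n.choose ij.1 : ℝ) * (pochK a k ij.1 * pochK b k ij.2 * g ij.1)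

theorem polyaSum_add (a b k : ℝ) (n : ℕ) (g h : ℕ → ℝ) :
    polyaSum a b k n (fun m => g m + h m) = polyaSum a b k n g + polyaSum a b k n h := by
  simp only [polyaSum, mul_add, Finset.sum_add_distrib]

theorem polyaSum_const_mul (a b k : ℝ) (n : ℕ) (c : ℝ) (g : ℕ → ℝ) :
    polyaSum a b k n (fun m => c * g m) = c * polyaSum a b k n g := by
  simp only [polyaSum, Finset.mul_sum]
  exact Finset.sum_congr rfl fun _ _ => by ring

theorem polyaSum_mono {a b k : ℝ} (ha : 0 ≤ a) (hb : 0 ≤ b) (hk : 0 ≤ k) {n : ℕ} {g h : ℕ → ℝ}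
    (hgh : ∀ m ≤ n, g m ≤ h m) : polyaSum a b k n g ≤ polyaSum a b k n h := by
  refine Finset.sum_le_sum fun ij hij => ?_
  have h₁ := pochK_nonneg ha hk ij.1
  have h₂ := pochK_nonneg hb hk ij.2
  have h₃ := hgh ij.1 (by rw [HasAntidiagonal.mem_antidiagonal] at hij; omega)
  gcongr

theorem abs_polyaSum_le {a b k : ℝ} (ha : 0 ≤ a) (hb : 0 ≤ b) (hk : 0 ≤ k) {n : ℕ} {g h : ℕ → ℝ}
    (hgh : ∀ m ≤ n, |g m| ≤ h m) : |polyaSum a b k n g| ≤ polyaSum a b k n h := by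
  refine abs_le.2 ⟨?_, polyaSum_mono ha hb hk fun m hm => (abs_le.1 (hgh m hm)).2⟩
  have := polyaSum_mono ha hb hk (n := n) (g := fun m => (-1) * h m) (h := g)
    fun m hm => by linarith [(abs_le.1 (hgh m hm)).1]
  rw [polyaSum_const_mul] at this
  linarith

theorem polyaSum_succ (a b k : ℝ) (n : ℕ) (g : ℕ → ℝ) :
    polyaSum a b k (n + 1) g =
      polyaSum a b k n fun m => (b + (n - m) * k) * g m + (a + m * k) * g (m + 1) := by
  unfold polyaSum
  rw [Finset.sum_antidiagonal_choose_succ_mul (fun i j => pochK a k i * pochK b k j * g i),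
    ← Finset.sum_add_distrib]
  refine Finset.sum_congr rfl fun ij hij => ?_
  rw [HasAntidiagonal.mem_antidiagonal] at hij
  have hn : (n : ℝ) = ij.1 + ij.2 := by exact_mod_cast hij.symm
  have hc : n.choose ij.2 = n.choose ij.1 := (Nat.choose_symm_of_eq_add hij.symm).symm
  simp only [pochK_succ, hc, hn]
  ring

theorem polyaSum_one (a b k : ℝ) (n : ℕ) :
    polyaSum a b k n (fun _ => 1) = pochK (a + b) k n := by
  induction n with
  | zero => simp [polyaSum, pochK]
  | succ n ih =>
    rw [polyaSum_succ, pochK_succ, ← ih, mul_comm, ← polyaSum_const_mul]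
    congr 1
    ext m
    ring

theorem polyaSum_id (a b k : ℝ) (n : ℕ) :
    (a + b) * polyaSum a b k n (fun m => m) = n * a * pochK (a + b) k n := by
  induction n with
  | zero => simp [polyaSum]
  | succ n ih =>
    have key : polyaSum a b k (n + 1) (fun m => m) =
        (a + b + (n + 1) * k) * polyaSum a b k n (fun m => m) +
          a * polyaSum a b k n (fun _ => 1) := by
      rw [polyaSum_succ, ← polyaSum_const_mul, ← polyaSum_const_mul, ← polyaSum_add]
      congr 1
      ext m
      push_cast
      ring
    rw [key, polyaSum_one, pochK_succ]
    push_cast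
    linear_combination (a + b + (n + 1) * k) * ih

theorem polyaSum_descFactorial_two (a b k : ℝ) (n : ℕ) :
    (a + b) * (a + b + k) * polyaSum a b k n (fun m => m * (m - 1)) =
      n * (n - 1) * a * (a + k) * pochK (a + b) k n := by
  induction n with
  | zero => simp [polyaSum]
  | succ n ih =>
    have key : polyaSum a b k (n + 1) (fun m => m * (m - 1)) =
        (a + b + (n + 2) * k) * polyaSum a b k n (fun m => m * (m - 1)) +
          2 * (a + k) * polyaSum a b k n (fun m => m) := by
      rw [polyaSum_succ, ← polyaSum_const_mul, ← polyaSum_const_mul, ← polyaSum_add]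
      congr 1
      ext m
      push_cast
      ring
    rw [key, pochK_succ]
    push_cast
    linear_combination (a + b + (n + 2) * k) * ih +
      2 * (a + k) * (a + b + k) * polyaSum_id a b k n

theorem LupasP_eq_polyaSum (n : ℕ) (k : ℝ) (f : ℝ → ℝ) (x : ℝ) :
    LupasP n k f x =
      polyaSum (n * x) (n - n * x) k n (fun m => f (m / n)) / pochK n k n := by
  rw [LupasP, polyaSum, Finset.Nat.sum_antidiagonal_eq_sum_range_succ_mk, one_div_mul_eq_div]
  simp only [mul_assoc]

/-- The second central moment of the Lupaş-type operator. -/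
theorem polyaSum_sub_sq {n : ℕ} (hn : 0 < n) {k : ℝ} (hk : 0 ≤ k) (x : ℝ) :
    polyaSum (n * x) (n - n * x) k n (fun m => ((m : ℝ) / n - x) ^ 2) =
      (k + 1) * x * (1 - x) / (n + k) * pochK n k n := by
  have hn' : (0 : ℝ) < n := by exact_mod_cast hn
  have hnk : (0 : ℝ) < n + k := by linarith
  have h₀ := polyaSum_one (n * x) (n - n * x) k n
  have h₁ := polyaSum_id (n * x) (n - n * x) k n
  have h₂ := polyaSum_descFactorial_two (n * x) (n - n * x) k n
  rw [add_sub_cancel] at h₀ h₁ h₂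
  have key : polyaSum (n * x) (n - n * x) k n (fun m => ((m : ℝ) / n - x) ^ 2) =
      1 / (n : ℝ) ^ 2 * polyaSum (n * x) (n - n * x) k n (fun m => m * (m - 1)) +
        ((1 / (n : ℝ) ^ 2 - 2 * x / n) * polyaSum (n * x) (n - n * x) k n (fun m => m) +
          x ^ 2 * polyaSum (n * x) (n - n * x) k n (fun _ => 1)) := by
    rw [← polyaSum_const_mul, ← polyaSum_const_mul, ← polyaSum_const_mul, ← polyaSum_add,
      ← polyaSum_add]
    congr 1
    ext m
    field_simp
    ring
  have h₁' : polyaSum (n * x) (n - n * x) k n (fun m => m) = n * x * pochK n k n := by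
    apply mul_left_cancel₀ hn'.ne'
    linear_combination h₁
  have h₂' : polyaSum (n * x) (n - n * x) k n (fun m => m * (m - 1)) =
      n * (n - 1) * x * (n * x + k) / (n + k) * pochK n k n := by
    apply mul_left_cancel₀ (mul_pos hn' hnk).ne'
    rw [h₂]
    field_simp
  rw [key, h₀, h₁', h₂']
  field_simp
  ring

theorem abs_sub_le_modulus {f : ℝ → ℝ} (hf : ContinuousOn f (Set.Icc (0 : ℝ) 1)) {δ x t : ℝ}
    (hx : x ∈ Set.Icc (0 : ℝ) 1) (ht : t ∈ Set.Icc (0 : ℝ) 1) (h : |t - x| ≤ δ) :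
    |f t - f x| ≤ modulus f δ := by
  obtain ⟨C, hC⟩ := isCompact_Icc.exists_bound_of_continuousOn hf
  refine le_csSup ⟨C + C, ?_⟩ ⟨x, t, hx, ht, h, rfl⟩
  rintro _ ⟨y, s, hy, hs, -, rfl⟩
  exact (abs_sub _ _).trans (add_le_add (hC s hs) (hC y hy))

theorem modulus_nonneg (f : ℝ → ℝ) (δ : ℝ) : 0 ≤ modulus f δ :=
  Real.sSup_nonneg (by rintro _ ⟨_, _, _, _, _, rfl⟩; exact abs_nonneg _)

theorem abs_sub_le_nat_mul_modulus {f : ℝ → ℝ} (hf : ContinuousOn f (Set.Icc (0 : ℝ) 1))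
    {δ x : ℝ} (hx : x ∈ Set.Icc (0 : ℝ) 1) (N : ℕ) :
    ∀ t ∈ Set.Icc (0 : ℝ) 1, |t - x| ≤ N * δ → |f t - f x| ≤ N * modulus f δ := by
  induction N with
  | zero =>
    intro t _ h
    have : t = x := by simpa [sub_eq_zero] using h
    simp [this]
  | succ N ih =>
    intro t ht h
    push_cast at h ⊢
    have hN : (0 : ℝ) < N + 1 := by positivity
    set y := x + (t - x) * (N / (N + 1)) with hy
    have hyx : y - x = (t - x) / (N + 1) * N := by rw [hy]; ring
    have hty : t - y = (t - x) / (N + 1) := by rw [hy]; field_simp; ring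
    have hδ : |(t - x) / (N + 1)| ≤ δ := by
      rw [abs_div, abs_of_pos hN, div_le_iff₀ hN]
      linarith
    have hy01 : y ∈ Set.Icc (0 : ℝ) 1 := by
      have hN1 : (N : ℝ) / (N + 1) ≤ 1 := by
        rw [div_le_one hN]
        linarith
      have := (convex_Icc (0 : ℝ) 1).add_smul_sub_mem hx ht ⟨by positivity, hN1⟩
      rwa [smul_eq_mul, mul_comm] at this
    have h₁ := ih y hy01 (by
      rw [hyx, abs_mul, Nat.abs_cast, mul_comm]
      gcongr)
    have h₂ := abs_sub_le_modulus hf hy01 ht (hty ▸ hδ)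
    linarith [abs_sub_le (f t) (f y) (f x)]

theorem abs_sub_le_one_add_div_mul_modulus {f : ℝ → ℝ} (hf : ContinuousOn f (Set.Icc (0 : ℝ) 1))
    {δ x t : ℝ} (hδ : 0 < δ) (hx : x ∈ Set.Icc (0 : ℝ) 1) (ht : t ∈ Set.Icc (0 : ℝ) 1) :
    |f t - f x| ≤ (1 + |t - x| / δ) * modulus f δ := by
  refine (abs_sub_le_nat_mul_modulus (δ := δ) hf hx ⌈|t - x| / δ⌉₊ t ht ?_).trans ?_
  · exact (div_le_iff₀ hδ).1 (Nat.le_ceil _)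
  · have := (Nat.ceil_lt_add_one (a := |t - x| / δ) (by positivity)).le
    exact mul_le_mul_of_nonneg_right (by linarith) (modulus_nonneg f δ)

theorem lupas_modulus_estimate (n : ℕ) (hn : 0 < n) (k : ℝ) (hk : 0 ≤ k)
    (x : ℝ) (hx : x ∈ Set.Icc (0:ℝ) 1)
    (f : ℝ → ℝ) (hf : ContinuousOn f (Set.Icc (0:ℝ) 1)) :
    |LupasP n k f x - f x| ≤ (3 / 2) * modulus f (Real.sqrt ((k + 1) / (n + k))) := by
  have hn' : (0 : ℝ) < n := by exact_mod_cast hn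
  have hnk : (0 : ℝ) < n + k := by linarith
  have hq : 0 < (k + 1) / (n + k) := by positivity
  have hδ := Real.sqrt_pos.2 hq
  have hδ2 := Real.sq_sqrt hq.le
  set δ := Real.sqrt ((k + 1) / (n + k))
  have hp := pochK_pos hn' hk n
  have hω := modulus_nonneg f δ
  have ha : 0 ≤ n * x := mul_nonneg hn'.le hx.1
  have hb : 0 ≤ n - n * x := by nlinarith [hx.2]
  have h₀ := polyaSum_one (n * x) (n - n * x) k n
  rw [add_sub_cancel] at h₀
  have hdiff : LupasP n k f x - f x =
      polyaSum (n * x) (n - n * x) k n (fun m => f (m / n) + -f x * 1) / pochK n k n := by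
    rw [polyaSum_add, polyaSum_const_mul, h₀, LupasP_eq_polyaSum]
    field_simp
    ring
  rw [hdiff, abs_div, abs_of_pos hp, div_le_iff₀ hp]
  have hpt : ∀ m ≤ n, |f ((m : ℝ) / n) + -f x * 1| ≤
      (5 / 4 * modulus f δ) * 1 + modulus f δ / δ ^ 2 * ((m : ℝ) / n - x) ^ 2 := by
    intro m hm
    have hm' : (m : ℝ) / n ∈ Set.Icc (0 : ℝ) 1 :=
      ⟨by positivity, (div_le_one hn').2 (by exact_mod_cast hm)⟩
    have h := abs_sub_le_one_add_div_mul_modulus hf hδ hx hm'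
    have hsq : (|(m : ℝ) / n - x| / δ) ^ 2 = ((m : ℝ) / n - x) ^ 2 / δ ^ 2 := by
      rw [div_pow, sq_abs]
    have hle : 1 + |(m : ℝ) / n - x| / δ ≤ 5 / 4 + ((m : ℝ) / n - x) ^ 2 / δ ^ 2 := by
      rw [← hsq]
      nlinarith [sq_nonneg (|(m : ℝ) / n - x| / δ - 1 / 2)]
    calc |f ((m : ℝ) / n) + -f x * 1| = |f ((m : ℝ) / n) - f x| := by ring_nf
      _ ≤ _ := h.trans (mul_le_mul_of_nonneg_right hle hω)
      _ = _ := by ring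
  refine (abs_polyaSum_le ha hb hk hpt).trans ?_
  rw [polyaSum_add, polyaSum_const_mul, polyaSum_const_mul, h₀, polyaSum_sub_sq hn hk, hδ2]
  have hcancel : modulus f δ / ((k + 1) / (n + k)) *
      ((k + 1) * x * (1 - x) / (n + k) * pochK n k n) =
        x * (1 - x) * (modulus f δ * pochK n k n) := by
    have : k + 1 ≠ 0 := by positivity
    field_simp
  rw [hcancel]
  have hx4 : x * (1 - x) ≤ 1 / 4 := by nlinarith [sq_nonneg (x - 1 / 2)]
  linarith [mul_le_mul_of_nonneg_right hx4 (mul_nonneg hω hp.le)]
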